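/- arXiv:1308.3994 — 2 statements merged into one kernel-verified Lean document; each statement's English description precedes it below -/
import Mathlib

section
/- Let C > 0 and let W_vol : (0,∞) → ℝ be a C² function with W_vol(t) = 0 if and only if t = 1, W_vol(t) → +∞ as t → 0⁺, W_vol(t) ≥ k t² for all t ≥ M for some constants M, k > 0, and W_vol''(1) > 0. Define W_comp(F) := C(‖F‖²/(det F)^{2/3} − 3) + W_vol(det F) for every F ∈ ℝ^{3×3} with det F > 0. Then W_comp(F) ≥ 0 for all such F, and W_comp(F) = 0 if and only if F ∈ SO(3). -/
open Matrix Filter Topology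

noncomputable section

/-- Frobenius norm of a real `3 × 3` matrix. -/
def frob (F : Matrix (Fin 3) (Fin 3) ℝ) : ℝ :=
  Real.sqrt (∑ i, ∑ j, (F i j) ^ 2)

/-- The special orthogonal group `SO(3)` as a set of matrices. -/
def SO3 : Set (Matrix (Fin 3) (Fin 3) ℝ) :=
  {R | R * Rᵀ = 1 ∧ R.det = 1}

/-- The conditions on the volumetric energy `W_vol`:
`W_vol ∈ C²((0,∞))`, `W_vol(t) = 0 ↔ t = 1` (on `(0,∞)`), `W_vol(t) → +∞` as `t → 0⁺`,
`W_vol(t) ≥ k t²` for `t ≥ M` (for some `M, k > 0`), and `W_vol''(1) > 0`. -/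
structure WvolHyp (Wvol : ℝ → ℝ) : Prop where
  c2 : ContDiffOn ℝ 2 Wvol (Set.Ioi (0 : ℝ))
  zero_iff : ∀ t : ℝ, 0 < t → (Wvol t = 0 ↔ t = 1)
  tendsto_top : Tendsto Wvol (𝓝[>] (0 : ℝ)) atTop
  quad_growth : ∃ M > (0 : ℝ), ∃ k > (0 : ℝ), ∀ t : ℝ, M ≤ t → k * t ^ 2 ≤ Wvol t
  second_deriv_pos : 0 < deriv (deriv Wvol) 1

lemma frob_sq (F : Matrix (Fin 3) (Fin 3) ℝ) : frob F ^ 2 = ∑ i, ∑ j, F i j ^ 2 :=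
  Real.sq_sqrt (by positivity)

lemma sum_adjugate_sq_le (F : Matrix (Fin 3) (Fin 3) ℝ) :
    3 * ∑ i, ∑ j, F.adjugate i j ^ 2 ≤ (∑ i, ∑ j, F i j ^ 2) ^ 2 := by
  simp only [adjugate_fin_three, Fin.sum_univ_three, of_apply, cons_val', cons_val_zero,
    cons_val_one, cons_val, cons_val_fin_one]
  generalize F 0 0 = a, F 0 1 = b, F 0 2 = c, F 1 0 = d, F 1 1 = e, F 1 2 = f,
    F 2 0 = g, F 2 1 = h, F 2 2 = i
  linarith [sq_nonneg (a * d + b * e + c * f), sq_nonneg (a * g + b * h + c * i),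
    sq_nonneg (d * g + e * h + f * i),
    sq_nonneg (a ^ 2 + b ^ 2 + c ^ 2 - (d ^ 2 + e ^ 2 + f ^ 2)),
    sq_nonneg (a ^ 2 + b ^ 2 + c ^ 2 - (g ^ 2 + h ^ 2 + i ^ 2)),
    sq_nonneg (d ^ 2 + e ^ 2 + f ^ 2 - (g ^ 2 + h ^ 2 + i ^ 2))]

lemma sum_smul_sub_smul_adjugate_sq (F : Matrix (Fin 3) (Fin 3) ℝ) (x y : ℝ) :
    ∑ i, ∑ j, (x * F i j - y * F.adjugate j i) ^ 2 =
      x ^ 2 * (∑ i, ∑ j, F i j ^ 2) - 6 * x * y * F.det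
        + y ^ 2 * ∑ i, ∑ j, F.adjugate i j ^ 2 := by
  simp only [adjugate_fin_three, det_fin_three, Fin.sum_univ_three, of_apply, cons_val',
    cons_val_zero, cons_val_one, cons_val, cons_val_fin_one]
  ring

lemma det_sq_le_frob_sq_pow (F : Matrix (Fin 3) (Fin 3) ℝ) :
    27 * F.det ^ 2 ≤ (frob F ^ 2) ^ 3 := by
  have hadj := sum_adjugate_sq_le F
  have hsub := sum_smul_sub_smul_adjugate_sq F (3 * F.det) (∑ i, ∑ j, F i j ^ 2)
  have hsq : 0 ≤ ∑ i, ∑ j,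
      (3 * F.det * F i j - (∑ i, ∑ j, F i j ^ 2) * F.adjugate j i) ^ 2 := by positivity
  have hs : 0 ≤ ∑ i, ∑ j, F i j ^ 2 := by positivity
  rw [hsub] at hsq
  rw [frob_sq]
  rcases hs.eq_or_lt with h0 | hpos
  · have hF : ∀ i j, F i j = 0 := by
      intro i j
      have h1 := (Finset.sum_eq_zero_iff_of_nonneg (fun i _ => by positivity)).1 h0.symm i
        (Finset.mem_univ i)
      have h2 := (Finset.sum_eq_zero_iff_of_nonneg (fun j _ => by positivity)).1 h1 j
        (Finset.mem_univ j)
      exact pow_eq_zero_iff two_ne_zero |>.1 h2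
    simp [det_fin_three, hF]
  · generalize (∑ i, ∑ j, F i j ^ 2) = s at *
    generalize (∑ i, ∑ j, F.adjugate i j ^ 2) = c at *
    have hsc : 0 ≤ s * (s * c - 9 * F.det ^ 2) := by linarith
    have := nonneg_of_mul_nonneg_right hsc hpos
    nlinarith [mul_le_mul_of_nonneg_left hadj hs]

lemma mul_transpose_eq_one_of_frob_sq_le {F : Matrix (Fin 3) (Fin 3) ℝ} (hdet : F.det = 1)
    (hF : frob F ^ 2 ≤ 3) : F * Fᵀ = 1 := by
  rw [frob_sq] at hF
  have hadj := sum_adjugate_sq_le F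
  have hsub := sum_smul_sub_smul_adjugate_sq F 1 1
  have hs : 0 ≤ ∑ i, ∑ j, F i j ^ 2 := by positivity
  have h0 : ∑ i, ∑ j, (1 * F i j - 1 * F.adjugate j i) ^ 2 = 0 := by
    refine le_antisymm ?_ (by positivity)
    rw [hsub, hdet]
    nlinarith
  have hFadj : Fᵀ = F.adjugate := by
    ext j i
    have h1 := (Finset.sum_eq_zero_iff_of_nonneg (fun i _ => by positivity)).1 h0 i
      (Finset.mem_univ i)
    have h2 := (Finset.sum_eq_zero_iff_of_nonneg (fun j _ => by positivity)).1 h1 j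
      (Finset.mem_univ j)
    have h3 := (pow_eq_zero_iff two_ne_zero).1 h2
    rw [transpose_apply]
    linarith
  rw [hFadj, mul_adjugate, hdet, one_smul]

lemma frob_sq_eq_trace (F : Matrix (Fin 3) (Fin 3) ℝ) : frob F ^ 2 = (F * Fᵀ).trace := by
  rw [frob_sq]
  simp [trace, mul_apply, sq]

lemma three_le_frob_sq_div {F : Matrix (Fin 3) (Fin 3) ℝ} (hdet : 0 < F.det) :
    3 ≤ frob F ^ 2 / F.det ^ ((2 : ℝ) / 3) := by
  rw [le_div_iff₀ (by positivity)]
  refine le_of_pow_le_pow_left₀ three_ne_zero (by positivity) ?_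
  have hq : (F.det ^ ((2 : ℝ) / 3)) ^ 3 = F.det ^ 2 := by
    rw [← Real.rpow_natCast, ← Real.rpow_mul hdet.le, ← Real.rpow_natCast]
    norm_num
  rw [mul_pow, hq]
  linarith [det_sq_le_frob_sq_pow F]

lemma IsPreconnected.pos_of_ne_zero {s : Set ℝ} (hs : IsPreconnected s) {f : ℝ → ℝ}
    (hf : ContinuousOn f s) (hne : ∀ x ∈ s, f x ≠ 0) {a b : ℝ} (ha : a ∈ s) (hb : b ∈ s)
    (hfa : 0 < f a) : 0 < f b := by
  by_contra! hfb
  obtain ⟨x, hx, hx0⟩ := hs.intermediate_value hb ha hf ⟨hfb, hfa.le⟩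
  exact hne x hx hx0

lemma WvolHyp.nonneg {Wvol : ℝ → ℝ} (hW : WvolHyp Wvol) {t : ℝ} (ht : 0 < t) :
    0 ≤ Wvol t := by
  have hcont := hW.c2.continuousOn
  rcases lt_trichotomy t 1 with h | rfl | h
  · obtain ⟨a, ha, ha0, ha1⟩ := ((hW.tendsto_top.eventually_gt_atTop 0).and
      (Ioo_mem_nhdsGT (zero_lt_one' ℝ))).exists
    exact (isPreconnected_Ioo.pos_of_ne_zero (hcont.mono Set.Ioo_subset_Ioi_self)
      (fun x hx h0 => hx.2.ne ((hW.zero_iff x hx.1).1 h0)) ⟨ha0, ha1⟩ ⟨ht, h⟩ ha).le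
  · exact ((hW.zero_iff 1 ht).2 rfl).ge
  · obtain ⟨M, -, k, hk, hgrowth⟩ := hW.quad_growth
    have ha : 1 < max M 2 := lt_max_of_lt_right one_lt_two
    have hpos : 0 < Wvol (max M 2) :=
      lt_of_lt_of_le (by positivity) (hgrowth _ (le_max_left M 2))
    exact (isPreconnected_Ioi.pos_of_ne_zero
      (hcont.mono (Set.Ioi_subset_Ioi zero_le_one))
      (fun x hx h0 => (ne_of_gt hx) ((hW.zero_iff x (zero_lt_one.trans hx)).1 h0))
      ha h hpos).le

/-- with `W_comp(F) = C(‖F‖²/(det F)^{2/3} − 3) + W_vol(det F)` for `det F > 0`,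
one has `W_comp(F) ≥ 0`, and `W_comp(F) = 0` iff `F ∈ SO(3)`. -/
theorem Wcomp_nonneg_zero_iff (C : ℝ) (hC : 0 < C) (Wvol : ℝ → ℝ) (hW : WvolHyp Wvol) :
    ∀ F : Matrix (Fin 3) (Fin 3) ℝ, 0 < F.det →
      0 ≤ C * ((frob F) ^ 2 / F.det ^ ((2 : ℝ) / 3) - 3) + Wvol F.det ∧
      (C * ((frob F) ^ 2 / F.det ^ ((2 : ℝ) / 3) - 3) + Wvol F.det = 0 ↔ F ∈ SO3) := by
  intro F hdet
  have hW0 := hW.nonneg hdet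
  have hiso := mul_nonneg hC.le (sub_nonneg.2 (three_le_frob_sq_div hdet))
  refine ⟨add_nonneg hiso hW0, fun h => ?_, fun ⟨hF, hF1⟩ => ?_⟩
  · obtain ⟨hiso0, hvol0⟩ := (add_eq_zero_iff_of_nonneg hiso hW0).1 h
    have hdet1 := (hW.zero_iff _ hdet).1 hvol0
    rw [hdet1, Real.one_rpow, div_one] at hiso0
    have h3 := (mul_eq_zero.1 hiso0).resolve_left hC.ne'
    exact ⟨mul_transpose_eq_one_of_frob_sq_le hdet1 (by linarith), hdet1⟩
  · rw [hF1, (hW.zero_iff 1 one_pos).2 rfl, frob_sq_eq_trace, hF]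
    simp
end
end

section
/- Let μ > 0, a > 1, and let W_vol : (0,∞) → ℝ be a C² function with W_vol(t) = 0 if and only if t = 1, W_vol(t) → +∞ as t → 0⁺, W_vol(t) ≥ k t² for all t ≥ M for some constants M, k > 0, and W_vol''(1) > 0. For F ∈ ℝ^{3×3} with det F > 0, define W(F) := min_{n ∈ S²} (μ/2)(tr(Fᵀ L_n^{−1} F)/(det F)^{2/3} − 3) + W_vol(det F), where L_n := a^{2/3} n⊗n + a^{−1/3}(I − n⊗n). Then W(F) ≥ 0 for all F with det F > 0, and W(F) = 0 if and only if F ∈ 𝓤 := { L_n^{1/2} R : n ∈ S², R ∈ SO(3) }, where L_n^{1/2} := a^{1/3} n⊗n + a^{−1/6}(I − n⊗n). -/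
open Matrix Filter Topology

noncomputable section

/-- The unit sphere `S²` as a subtype of `ℝ³`. -/
def Sph : Type := {n : Fin 3 → ℝ // ∑ i, (n i) ^ 2 = 1}

/-- `L_n = a^{2/3} n⊗n + a^{-1/3}(I - n⊗n)`. -/
def Ln (a : ℝ) (n : Fin 3 → ℝ) : Matrix (Fin 3) (Fin 3) ℝ :=
  a ^ ((2 : ℝ) / 3) • Matrix.vecMulVec n n +
    a ^ (-(1 : ℝ) / 3) • (1 - Matrix.vecMulVec n n)

/-- `L_n^{1/2} = a^{1/3} n⊗n + a^{-1/6}(I - n⊗n)`. -/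
def Lhalf (a : ℝ) (n : Fin 3 → ℝ) : Matrix (Fin 3) (Fin 3) ℝ :=
  a ^ ((1 : ℝ) / 3) • Matrix.vecMulVec n n +
    a ^ (-(1 : ℝ) / 6) • (1 - Matrix.vecMulVec n n)

/-- The compressible nematic-elastomer energy
`W(F) = min_{n∈S²} (μ/2)(tr(Fᵀ L_n⁻¹ F)/(det F)^{2/3} − 3) + W_vol(det F)`. -/
def Wnem (μ a : ℝ) (Wvol : ℝ → ℝ) (F : Matrix (Fin 3) (Fin 3) ℝ) : ℝ :=
  ⨅ n : Sph, (μ / 2 * (Matrix.trace (Fᵀ * (Ln a n.1)⁻¹ * F) / F.det ^ ((2 : ℝ) / 3) - 3)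
    + Wvol F.det)

/-- The matrix `α n⊗n + β (I - n⊗n)`. -/
def uniaxial (n : Fin 3 → ℝ) (α β : ℝ) : Matrix (Fin 3) (Fin 3) ℝ :=
  α • vecMulVec n n + β • (1 - vecMulVec n n)

lemma uniaxial_mul {n : Fin 3 → ℝ} (hn : ∑ i, (n i) ^ 2 = 1) (α β α' β' : ℝ) :
    uniaxial n α β * uniaxial n α' β' = uniaxial n (α * α') (β * β') := by
  have hP : vecMulVec n n * vecMulVec n n = vecMulVec n n := by
    have h : n ⬝ᵥ n = 1 := by simpa [dotProduct, pow_two] using hn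
    rw [vecMulVec_mul_vecMulVec, h]
    simp
  simp only [uniaxial, add_mul, mul_add, sub_mul, mul_sub, smul_mul_assoc, mul_smul_comm, hP,
    one_mul, mul_one, sub_self, smul_zero, add_zero]
  module

lemma uniaxial_one_one (n : Fin 3 → ℝ) : uniaxial n 1 1 = 1 := by
  simp [uniaxial]

lemma transpose_uniaxial (n : Fin 3 → ℝ) (α β : ℝ) :
    (uniaxial n α β)ᵀ = uniaxial n α β := by
  simp [uniaxial, transpose_vecMulVec]

lemma det_uniaxial {n : Fin 3 → ℝ} (hn : ∑ i, (n i) ^ 2 = 1) (α β : ℝ) :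
    (uniaxial n α β).det = α * β ^ 2 := by
  rw [Fin.sum_univ_three] at hn
  simp [uniaxial, det_fin_three, vecMulVec_apply, one_apply]
  linear_combination β ^ 2 * (α - β) * hn

lemma continuous_uniaxial (α β : ℝ) :
    Continuous fun n : Fin 3 → ℝ => uniaxial n α β := by
  unfold uniaxial
  fun_prop

/-- The inverse of `Lhalf a n`, for `n` a unit vector and `0 < a`. -/
def LhalfInv (a : ℝ) (n : Fin 3 → ℝ) : Matrix (Fin 3) (Fin 3) ℝ :=
  uniaxial n (a ^ (-(1 : ℝ) / 3)) (a ^ ((1 : ℝ) / 6))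

lemma Lhalf_mul_LhalfInv {a : ℝ} (ha : 0 < a) {n : Fin 3 → ℝ} (hn : ∑ i, (n i) ^ 2 = 1) :
    Lhalf a n * LhalfInv a n = 1 := by
  change uniaxial n _ _ * uniaxial n _ _ = 1
  rw [uniaxial_mul hn, ← Real.rpow_add ha, ← Real.rpow_add ha]
  norm_num [uniaxial_one_one]

lemma det_Lhalf {a : ℝ} (ha : 0 < a) {n : Fin 3 → ℝ} (hn : ∑ i, (n i) ^ 2 = 1) :
    (Lhalf a n).det = 1 := by
  change (uniaxial n _ _).det = 1
  rw [det_uniaxial hn, ← Real.rpow_natCast, ← Real.rpow_mul ha.le, ← Real.rpow_add ha]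
  norm_num

lemma det_LhalfInv {a : ℝ} (ha : 0 < a) {n : Fin 3 → ℝ} (hn : ∑ i, (n i) ^ 2 = 1) :
    (LhalfInv a n).det = 1 := by
  have h := congrArg det (Lhalf_mul_LhalfInv ha hn)
  simpa [det_mul, det_Lhalf ha hn] using h

lemma Ln_inv {a : ℝ} (ha : 0 < a) {n : Fin 3 → ℝ} (hn : ∑ i, (n i) ^ 2 = 1) :
    (Ln a n)⁻¹ = uniaxial n (a ^ (-(2 : ℝ) / 3)) (a ^ ((1 : ℝ) / 3)) := by
  apply Matrix.inv_eq_right_inv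
  change uniaxial n _ _ * uniaxial n _ _ = 1
  rw [uniaxial_mul hn, ← Real.rpow_add ha, ← Real.rpow_add ha]
  norm_num [uniaxial_one_one]

lemma Ln_inv_eq_transpose_mul {a : ℝ} (ha : 0 < a) {n : Fin 3 → ℝ}
    (hn : ∑ i, (n i) ^ 2 = 1) :
    (Ln a n)⁻¹ = (LhalfInv a n)ᵀ * LhalfInv a n := by
  rw [Ln_inv ha hn, LhalfInv, transpose_uniaxial, uniaxial_mul hn, ← Real.rpow_add ha,
    ← Real.rpow_add ha]
  norm_num

lemma trace_Ln_inv {a : ℝ} (ha : 0 < a) {n : Fin 3 → ℝ} (hn : ∑ i, (n i) ^ 2 = 1)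
    (F : Matrix (Fin 3) (Fin 3) ℝ) :
    trace (Fᵀ * (Ln a n)⁻¹ * F) = trace ((LhalfInv a n * F)ᵀ * (LhalfInv a n * F)) := by
  simp only [Ln_inv_eq_transpose_mul ha hn, transpose_mul, mul_assoc]

lemma amgm_three {x y z : ℝ} (hx : 0 ≤ x) (hy : 0 ≤ y) (hz : 0 ≤ z) :
    27 * (x * y * z) ≤ (x + y + z) ^ 3 := by
  nlinarith [mul_nonneg hx (sq_nonneg (y - z)), mul_nonneg hy (sq_nonneg (x - z)),
    mul_nonneg hz (sq_nonneg (x - y)), mul_nonneg (add_nonneg (add_nonneg hx hy) hz)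
      (add_nonneg (add_nonneg (sq_nonneg (x - y)) (sq_nonneg (y - z))) (sq_nonneg (x - z)))]

lemma eq_one_of_sum_of_prod {x y z : ℝ} (hx : 0 ≤ x) (hy : 0 ≤ y) (hz : 0 ≤ z)
    (hs : x + y + z = 3) (hp : x * y * z = 1) : x = 1 := by
  have hyz : y * z ≤ ((3 - x) / 2) ^ 2 := by
    have : (3 - x) / 2 = (y + z) / 2 := by linarith
    rw [this]
    nlinarith [sq_nonneg (y - z)]
  have hx4 : 0 ≤ (x - 1) ^ 2 * (x - 4) := by
    nlinarith [mul_le_mul_of_nonneg_left hyz hx]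
  have hlt : x - 4 < 0 := by linarith
  have h0 : (x - 1) ^ 2 = 0 := by
    by_contra h
    have : 0 < (x - 1) ^ 2 := lt_of_le_of_ne (sq_nonneg _) (Ne.symm h)
    nlinarith [mul_neg_of_pos_of_neg this hlt]
  nlinarith [pow_eq_zero_iff (two_ne_zero) |>.mp h0]

lemma posSemidef_transpose_mul_self (G : Matrix (Fin 3) (Fin 3) ℝ) : (Gᵀ * G).PosSemidef := by
  simpa [conjTranspose_eq_transpose_of_trivial] using posSemidef_conjTranspose_mul_self G

lemma Matrix.PosSemidef.det_le_trace_cube {C : Matrix (Fin 3) (Fin 3) ℝ} (hC : C.PosSemidef) :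
    27 * C.det ≤ C.trace ^ 3 := by
  have ht := hC.isHermitian.trace_eq_sum_eigenvalues
  have hd := hC.isHermitian.det_eq_prod_eigenvalues
  simp only [Fin.sum_univ_three, Fin.prod_univ_three, RCLike.ofReal_real_eq_id, id] at ht hd
  rw [ht, hd]
  exact amgm_three (hC.eigenvalues_nonneg 0) (hC.eigenvalues_nonneg 1) (hC.eigenvalues_nonneg 2)

lemma Matrix.PosSemidef.eq_one_of_trace_of_det {C : Matrix (Fin 3) (Fin 3) ℝ}
    (hC : C.PosSemidef) (htr : C.trace = 3) (hdet : C.det = 1) : C = 1 := by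
  have ht := hC.isHermitian.trace_eq_sum_eigenvalues
  have hd := hC.isHermitian.det_eq_prod_eigenvalues
  simp only [Fin.sum_univ_three, Fin.prod_univ_three, RCLike.ofReal_real_eq_id, id] at ht hd
  rw [htr] at ht
  rw [hdet] at hd
  have h0 := hC.eigenvalues_nonneg 0
  have h1 := hC.eigenvalues_nonneg 1
  have h2 := hC.eigenvalues_nonneg 2
  have he0 := eq_one_of_sum_of_prod h0 h1 h2 ht.symm hd.symm
  have he1 := eq_one_of_sum_of_prod h1 h0 h2 (by linarith) (by linarith)
  have he2 := eq_one_of_sum_of_prod h2 h0 h1 (by linarith) (by linarith)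
  have he : hC.isHermitian.eigenvalues = fun _ => 1 := by
    funext i
    fin_cases i
    exacts [he0, he1, he2]
  have hs := hC.isHermitian.spectral_theorem
  rw [he] at hs
  rw [hs]
  simp

lemma three_mul_det_rpow_le_trace {G : Matrix (Fin 3) (Fin 3) ℝ} (hG : 0 < G.det) :
    3 * G.det ^ ((2 : ℝ) / 3) ≤ trace (Gᵀ * G) := by
  have hC := posSemidef_transpose_mul_self G
  have h := hC.det_le_trace_cube
  rw [det_mul, det_transpose] at h
  refine le_of_pow_le_pow_left₀ three_ne_zero hC.trace_nonneg ?_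
  have : (G.det ^ ((2 : ℝ) / 3)) ^ 3 = G.det * G.det := by
    rw [← Real.rpow_natCast, ← Real.rpow_mul hG.le]
    norm_num [sq]
  rw [mul_pow, this]
  linarith

lemma isCompact_sphere_sum_sq : IsCompact {n : Fin 3 → ℝ | ∑ i, (n i) ^ 2 = 1} := by
  refine Metric.isCompact_of_isClosed_isBounded
    (isClosed_eq (by fun_prop) continuous_const) ?_
  refine (Metric.isBounded_closedBall (x := (0 : Fin 3 → ℝ)) (r := 1)).subset fun n hn => ?_
  rw [mem_closedBall_zero_iff, pi_norm_le_iff_of_nonneg zero_le_one]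
  intro i
  rw [Real.norm_eq_abs, ← sq_le_one_iff_abs_le_one]
  exact (Finset.single_le_sum (fun j _ => sq_nonneg (n j)) (Finset.mem_univ i)).trans hn.le

/-- The infimum defining `Wnem` is attained. -/
lemma exists_isLeast_Wnem (μ : ℝ) {a : ℝ} (ha : 0 < a) (Wvol : ℝ → ℝ)
    (F : Matrix (Fin 3) (Fin 3) ℝ) :
    ∃ n : Sph,
      Wnem μ a Wvol F = μ / 2 * (trace (Fᵀ * (Ln a n.1)⁻¹ * F) / F.det ^ ((2 : ℝ) / 3) - 3)
        + Wvol F.det ∧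
      ∀ m : Sph, Wnem μ a Wvol F ≤
        μ / 2 * (trace (Fᵀ * (Ln a m.1)⁻¹ * F) / F.det ^ ((2 : ℝ) / 3) - 3) + Wvol F.det := by
  have hcont : ContinuousOn (fun n : Fin 3 → ℝ =>
      μ / 2 * (trace (Fᵀ * (Ln a n)⁻¹ * F) / F.det ^ ((2 : ℝ) / 3) - 3) + Wvol F.det)
      {n : Fin 3 → ℝ | ∑ i, (n i) ^ 2 = 1} := by
    have hu := continuous_uniaxial (a ^ (-(2 : ℝ) / 3)) (a ^ ((1 : ℝ) / 3))
    refine ContinuousOn.congr (f := fun n => μ / 2 * (trace (Fᵀ *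
      uniaxial n (a ^ (-(2 : ℝ) / 3)) (a ^ ((1 : ℝ) / 3)) * F) / F.det ^ ((2 : ℝ) / 3) - 3)
      + Wvol F.det) (Continuous.continuousOn ?_) fun n hn => by simp only [Ln_inv ha hn]
    have : Continuous fun n => trace (Fᵀ *
        uniaxial n (a ^ (-(2 : ℝ) / 3)) (a ^ ((1 : ℝ) / 3)) * F) :=
      ((continuous_const.matrix_mul hu).matrix_mul continuous_const).matrix_trace
    fun_prop
  obtain ⟨n, hn, hmin⟩ := isCompact_sphere_sum_sq.exists_isMinOn
    ⟨Pi.single 0 1, by simp [Fin.sum_univ_three]⟩ hcont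
  have : Nonempty Sph := ⟨⟨n, hn⟩⟩
  have hleast : ∀ m : Sph, _ := fun m : Sph => isMinOn_iff.1 hmin m.1 m.2
  have hbdd : BddBelow (Set.range fun m : Sph =>
      μ / 2 * (trace (Fᵀ * (Ln a m.1)⁻¹ * F) / F.det ^ ((2 : ℝ) / 3) - 3) + Wvol F.det) :=
    ⟨_, Set.forall_mem_range.2 hleast⟩
  exact ⟨⟨n, hn⟩, le_antisymm (ciInf_le hbdd ⟨n, hn⟩) (le_ciInf hleast), ciInf_le hbdd⟩

lemma trace_div_sub_three_nonneg {a : ℝ} (ha : 0 < a) {n : Fin 3 → ℝ}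
    (hn : ∑ i, (n i) ^ 2 = 1) {F : Matrix (Fin 3) (Fin 3) ℝ} (hF : 0 < F.det) :
    0 ≤ trace (Fᵀ * (Ln a n)⁻¹ * F) / F.det ^ ((2 : ℝ) / 3) - 3 := by
  have hd : (LhalfInv a n * F).det = F.det := by rw [det_mul, det_LhalfInv ha hn, one_mul]
  have h := three_mul_det_rpow_le_trace (hd ▸ hF)
  rw [hd] at h
  rw [trace_Ln_inv ha hn, sub_nonneg, le_div_iff₀ (Real.rpow_pos_of_pos hF _)]
  exact h

/-- `W(F) ≥ 0` for every `F` with `det F > 0`, and `W(F) = 0` iff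
`F ∈ 𝓤 = { L_n^{1/2} R : n ∈ S², R ∈ SO(3) }`. -/
theorem Wnem_nonneg_zero_iff (μ a : ℝ) (hμ : 0 < μ) (ha : 1 < a)
    (Wvol : ℝ → ℝ) (hW : WvolHyp Wvol) :
    ∀ F : Matrix (Fin 3) (Fin 3) ℝ, 0 < F.det →
      0 ≤ Wnem μ a Wvol F ∧
      (Wnem μ a Wvol F = 0 ↔
        ∃ n : Fin 3 → ℝ, (∑ i, (n i) ^ 2 = 1) ∧ ∃ R ∈ SO3, F = Lhalf a n * R) := by
  intro F hF
  have ha0 : 0 < a := one_pos.trans ha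
  obtain ⟨n, hn, hle⟩ := exists_isLeast_Wnem μ ha0 Wvol F
  have htr := mul_nonneg (half_pos hμ).le (trace_div_sub_three_nonneg ha0 n.2 hF)
  have hvol := hW.nonneg hF
  have hnonneg : 0 ≤ Wnem μ a Wvol F := hn ▸ add_nonneg htr hvol
  refine ⟨hnonneg, fun h0 => ?_, ?_⟩
  · rw [hn] at h0
    have hd : F.det = 1 := (hW.zero_iff _ hF).1 (by linarith)
    have ht : trace (Fᵀ * (Ln a n.1)⁻¹ * F) / F.det ^ ((2 : ℝ) / 3) - 3 = 0 :=
      (mul_eq_zero.1 (by linarith)).resolve_left (half_pos hμ).ne'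
    rw [hd, Real.one_rpow, div_one, trace_Ln_inv ha0 n.2, sub_eq_zero] at ht
    have hG : (LhalfInv a n.1 * F).det = 1 := by rw [det_mul, det_LhalfInv ha0 n.2, hd, one_mul]
    have hC := (posSemidef_transpose_mul_self _).eq_one_of_trace_of_det ht
      (by rw [det_mul, det_transpose, hG, one_mul])
    refine ⟨n.1, n.2, LhalfInv a n.1 * F, ⟨mul_eq_one_comm.1 hC, hG⟩, ?_⟩
    rw [← mul_assoc, Lhalf_mul_LhalfInv ha0 n.2, one_mul]
  · rintro ⟨m, hm, R, ⟨hR, hRdet⟩, rfl⟩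
    refine le_antisymm ((hle ⟨m, hm⟩).trans_eq ?_) hnonneg
    have hd : (Lhalf a m * R).det = 1 := by rw [det_mul, det_Lhalf ha0 hm, hRdet, one_mul]
    have hLR : LhalfInv a m * (Lhalf a m * R) = R := by
      rw [← mul_assoc, mul_eq_one_comm.1 (Lhalf_mul_LhalfInv ha0 hm), one_mul]
    rw [trace_Ln_inv ha0 hm, hd, hLR, mul_eq_one_comm.1 hR, (hW.zero_iff 1 one_pos).2 rfl]
    simp
end
end
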